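/- arXiv:1405.2878 — 5 statements merged into one kernel-verified Lean document; each statement's English description precedes it below -/
import Mathlib

section
/- For every integer k ≥ 1, the componentwise inequality v_{π*} − v_{σ_k} ≤ γ P_{π*} (v_{π*} − v_{σ_{k−1}}) + e_k holds, where e_k = max_{π'} T_{π'} v_{σ_{k−1}} − T_{π_k} v_{σ_{k−1}}. -/
open Finset Matrix

noncomputable section

/-- Transition matrix of a deterministic stationary policy. -/
def polMat {S A : Type*} (P : S → A → S → ℝ) (π : S → A) : Matrix S S ℝ :=
  Matrix.of fun s s' => P s (π s) s'

/-- Bellman operator `T_π v = r + γ P_π v` of a deterministic stationary policy. -/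
def bOp {S A : Type*} [Fintype S] (P : S → A → S → ℝ) (γ : ℝ) (r : S → ℝ)
    (π : S → A) (v : S → ℝ) : S → ℝ :=
  fun s => r s + γ * ∑ s' : S, P s (π s) s' * v s'

/-- `errOf P γ r v π = max_{π'} T_{π'} v − T_π v` (componentwise maximum over all
deterministic stationary policies `π'`). -/
def errOf {S A : Type*} [Fintype S] [Fintype A] [DecidableEq S] [Nonempty A]
    (P : S → A → S → ℝ) (γ : ℝ) (r : S → ℝ) (v : S → ℝ) (π : S → A) : S → ℝ :=
  fun s => (Finset.univ.sup' Finset.univ_nonempty fun π' : S → A => bOp P γ r π' v s)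
    - bOp P γ r π v s

/-- Values of the PSDP∞ non-stationary policies: `vSig P γ r πseq k = v_{σ_k}
= T_{π_k} T_{π_{k-1}} ⋯ T_{π_1} r` (so `vSig P γ r πseq 0 = r`). -/
def vSig {S A : Type*} [Fintype S] (P : S → A → S → ℝ) (γ : ℝ) (r : S → ℝ)
    (πseq : ℕ → S → A) : ℕ → S → ℝ
  | 0 => r
  | k+1 => bOp P γ r (πseq (k+1)) (vSig P γ r πseq k)

/-- for every `k ≥ 1`, componentwise,
`v_{π*} − v_{σ_k} ≤ γ P_{π*} (v_{π*} − v_{σ_{k−1}}) + e_k` where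
`e_k = max_{π'} T_{π'} v_{σ_{k−1}} − T_{π_k} v_{σ_{k−1}}`. -/
theorem stmt0
    {S A : Type*} [Fintype S] [Fintype A] [DecidableEq S] [Nonempty S] [Nonempty A]
    (P : S → A → S → ℝ) (hP0 : ∀ s a s', 0 ≤ P s a s')
    (hP1 : ∀ s a, ∑ s' : S, P s a s' = 1)
    (γ : ℝ) (hγ0 : 0 < γ) (hγ1 : γ < 1)
    (Rmax Vmax : ℝ) (r : S → ℝ) (hr : ∀ s, |r s| ≤ Rmax)
    (hVmax : Vmax = Rmax / (1 - γ))
    (πstar : S → A) (vstar : S → ℝ)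
    (hfix : bOp P γ r πstar vstar = vstar)
    (hopt : ∀ (π : S → A) (v : S → ℝ), bOp P γ r π v = v → ∀ s, v s ≤ vstar s)
    (πseq : ℕ → S → A) (k : ℕ) (hk : 1 ≤ k) :
    ∀ s, vstar s - vSig P γ r πseq k s ≤
      γ * (polMat P πstar).mulVec (fun s' => vstar s' - vSig P γ r πseq (k-1) s') s
        + errOf P γ r (vSig P γ r πseq (k-1)) (πseq k) s := by
  obtain ⟨n, rfl⟩ := Nat.exists_eq_add_of_le' hk
  intro s
  rw [Nat.add_sub_cancel]
  have hstar : vstar s = bOp P γ r πstar vstar s := (congrFun hfix s).symm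
  have hstep : vSig P γ r πseq (n + 1) s
      = bOp P γ r (πseq (n + 1)) (vSig P γ r πseq n) s := rfl
  have hmax := Finset.le_sup' (fun π' : S → A => bOp P γ r π' (vSig P γ r πseq n) s)
    (Finset.mem_univ πstar)
  have hsub : γ * (polMat P πstar).mulVec (fun s' => vstar s' - vSig P γ r πseq n s') s
      = bOp P γ r πstar vstar s - bOp P γ r πstar (vSig P γ r πseq n) s := by
    simp only [Matrix.mulVec, dotProduct, polMat, Matrix.of_apply, bOp, mul_sub,
      Finset.sum_sub_distrib]
    ring
  rw [hsub, hstep, ← hstar, errOf]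
  linarith
end
end

section
/- For every integer k ≥ 0, the componentwise inequality v_{π*} − v_{σ_k} ≤ Σ_{i=0}^{k−1} (γP_{π*})^i e_{k−i} + γ^k Vmax 𝟙 holds. -/
open Finset Matrix

noncomputable section

/-- The mean of `v` under a distribution is at most any upper bound of `v`. -/
theorem sum_mul_le_of_forall_le {S : Type*} [Fintype S] {p v : S → ℝ} {m : ℝ}
    (hp0 : ∀ s, 0 ≤ p s) (hp1 : ∑ s, p s = 1) (hv : ∀ s, v s ≤ m) :
    ∑ s, p s * v s ≤ m :=
  calc ∑ s, p s * v s ≤ ∑ s, p s * m :=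
        Finset.sum_le_sum fun s _ => mul_le_mul_of_nonneg_left (hv s) (hp0 s)
    _ = m := by rw [← Finset.sum_mul, hp1, one_mul]

/-- The value of a stationary policy is at most `Rmax / (1 - γ)`. -/
theorem le_div_of_bOp_eq_self {S A : Type*} [Fintype S] [Nonempty S]
    {P : S → A → S → ℝ} (hP0 : ∀ s a s', 0 ≤ P s a s')
    (hP1 : ∀ s a, ∑ s' : S, P s a s' = 1)
    {γ : ℝ} (hγ0 : 0 < γ) (hγ1 : γ < 1) {Rmax : ℝ} {r : S → ℝ} (hr : ∀ s, r s ≤ Rmax)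
    {π : S → A} {v : S → ℝ} (hfix : bOp P γ r π v = v) (s : S) :
    v s ≤ Rmax / (1 - γ) := by
  obtain ⟨t, ht⟩ := Finite.exists_max v
  refine (ht s).trans ?_
  have h : r t + γ * ∑ s', P t (π t) s' * v s' = v t := congrFun hfix t
  have hmean := mul_le_mul_of_nonneg_left
    (sum_mul_le_of_forall_le (hP0 t (π t)) (hP1 t (π t)) ht) hγ0.le
  rw [le_div_iff₀ (by linarith)]
  linarith [hr t]

theorem smul_polMat_mulVec_apply {S A : Type*} [Fintype S] (P : S → A → S → ℝ) (γ : ℝ)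
    (π : S → A) (x : S → ℝ) (s : S) :
    ((γ • polMat P π).mulVec x) s = γ * ∑ s', P s (π s) s' * x s' := by
  rw [Matrix.smul_mulVec]
  rfl

theorem bOp_sub_bOp_le_errOf {S A : Type*} [Fintype S] [Fintype A] [DecidableEq S] [Nonempty A]
    (P : S → A → S → ℝ) (γ : ℝ) (r v : S → ℝ) (π π' : S → A) (s : S) :
    bOp P γ r π' v s - bOp P γ r π v s ≤ errOf P γ r v π s :=
  sub_le_sub_right
    (Finset.le_sup' (fun π' : S → A => bOp P γ r π' v s) (Finset.mem_univ π')) _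

/-- for every `k ≥ 0`, componentwise,
`v_{π*} − v_{σ_k} ≤ Σ_{i=0}^{k−1} (γP_{π*})^i e_{k−i} + γ^k Vmax 𝟙`, where
`e_j = max_{π'} T_{π'} v_{σ_{j−1}} − T_{π_j} v_{σ_{j−1}}`. -/
theorem stmt1
    {S A : Type*} [Fintype S] [Fintype A] [DecidableEq S] [Nonempty S] [Nonempty A]
    (P : S → A → S → ℝ) (hP0 : ∀ s a s', 0 ≤ P s a s')
    (hP1 : ∀ s a, ∑ s' : S, P s a s' = 1)
    (γ : ℝ) (hγ0 : 0 < γ) (hγ1 : γ < 1)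
    (Rmax Vmax : ℝ) (r : S → ℝ) (hr : ∀ s, |r s| ≤ Rmax)
    (hVmax : Vmax = Rmax / (1 - γ))
    (πstar : S → A) (vstar : S → ℝ)
    (hfix : bOp P γ r πstar vstar = vstar)
    (hopt : ∀ (π : S → A) (v : S → ℝ), bOp P γ r π v = v → ∀ s, v s ≤ vstar s)
    (πseq : ℕ → S → A) (k : ℕ) :
    ∀ s, vstar s - vSig P γ r πseq k s ≤
      (∑ i ∈ Finset.range k,
        ((γ • polMat P πstar) ^ i).mulVec
          (errOf P γ r (vSig P γ r πseq (k - i - 1)) (πseq (k - i))) s)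
        + γ ^ k * Vmax := by
  induction k with
  | zero =>
    intro s
    have h : r s + γ * ∑ s', P s (πstar s) s' * vstar s' = vstar s := congrFun hfix s
    have hR : 0 ≤ Rmax := (abs_nonneg (r s)).trans (hr s)
    have hV : 0 ≤ Vmax := hVmax ▸ div_nonneg hR (by linarith)
    have hmean : ∑ s', P s (πstar s) s' * vstar s' ≤ Vmax :=
      sum_mul_le_of_forall_le (hP0 s _) (hP1 s _) fun t => hVmax ▸
        le_div_of_bOp_eq_self hP0 hP1 hγ0 hγ1 (fun t => (le_abs_self _).trans (hr t)) hfix t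
    simp only [vSig, Finset.range_zero, Finset.sum_empty, pow_zero]
    nlinarith
  | succ k ih =>
    intro s
    have herr := bOp_sub_bOp_le_errOf P γ r (vSig P γ r πseq k) (πseq (k + 1)) πstar s
    have hdiff : vstar s - bOp P γ r πstar (vSig P γ r πseq k) s =
        γ * ∑ s', P s (πstar s) s' * (vstar s' - vSig P γ r πseq k s') := by
      conv_lhs => rw [← hfix]
      simp only [bOp, mul_sub, Finset.sum_sub_distrib]
      ring
    have hmono := mul_le_mul_of_nonneg_left
      (Finset.sum_le_sum fun s' (_ : s' ∈ Finset.univ) =>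
        mul_le_mul_of_nonneg_left (ih s') (hP0 s (πstar s) s')) hγ0.le
    have hshift : ∀ i, ((γ • polMat P πstar) ^ (i + 1)).mulVec
          (errOf P γ r (vSig P γ r πseq (k - i - 1)) (πseq (k - i))) s =
        γ * ∑ s', P s (πstar s) s' * ((γ • polMat P πstar) ^ i).mulVec
          (errOf P γ r (vSig P γ r πseq (k - i - 1)) (πseq (k - i))) s' := by
      intro i
      rw [pow_succ', ← Matrix.mulVec_mulVec, smul_polMat_mulVec_apply]
    have hsum : γ * ∑ s', P s (πstar s) s' * ((∑ i ∈ Finset.range k,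
          ((γ • polMat P πstar) ^ i).mulVec
            (errOf P γ r (vSig P γ r πseq (k - i - 1)) (πseq (k - i))) s') + γ ^ k * Vmax) =
        (∑ i ∈ Finset.range k, ((γ • polMat P πstar) ^ (i + 1)).mulVec
          (errOf P γ r (vSig P γ r πseq (k - i - 1)) (πseq (k - i))) s)
          + γ ^ (k + 1) * Vmax := by
      simp only [hshift, mul_add, Finset.sum_add_distrib, ← Finset.sum_mul, hP1, one_mul]
      rw [← Finset.mul_sum]
      simp only [Finset.mul_sum]
      rw [Finset.sum_comm]
      ring
    rw [Finset.sum_range_succ']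
    simp only [Nat.add_sub_add_right, pow_zero, Matrix.one_mulVec, Nat.sub_zero,
      Nat.add_sub_cancel]
    change vstar s - bOp P γ r (πseq (k + 1)) (vSig P γ r πseq k) s ≤ _
    linarith
end
end

section
/- Let k ≥ 1, let ε ≥ 0 and ε_1,…,ε_k ≥ 0 satisfy ν e_j ≤ ε_j ≤ ε for all 1 ≤ j ≤ k. Then μ(v_{π*} − v_{σ_k}) ≤ Σ_{i=0}^{k−1} γ^i c_{π*}(i) ε_{k−i} + γ^k Vmax; in particular μ(v_{π*} − v_{σ_k}) ≤ (Σ_{i=0}^{k−1} γ^i c_{π*}(i)) ε + γ^k Vmax. -/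
open Finset Matrix

noncomputable section

/-- Expansion of a one-step recursion `a i (n+1) ≤ c i * e (n+1) + γ * a (i+1) n`. -/
theorem le_sum_of_step_le {γ V : ℝ} (hγ : 0 ≤ γ) (a : ℕ → ℕ → ℝ) (c e : ℕ → ℝ) (k : ℕ)
    (h0 : ∀ i, a i 0 ≤ V)
    (hstep : ∀ i n, n < k → a i (n + 1) ≤ c i * e (n + 1) + γ * a (i + 1) n) :
    ∀ n ≤ k, ∀ i, a i n ≤ (∑ j ∈ Finset.range n, γ ^ j * c (i + j) * e (n - j)) + γ ^ n * V := by
  intro n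
  induction n with
  | zero => intro _ i; simpa using h0 i
  | succ n ih =>
    intro hn i
    refine (hstep i n hn).trans ?_
    have h := mul_le_mul_of_nonneg_left (ih (by omega) (i + 1)) hγ
    rw [Finset.sum_range_succ']
    have hsum : ∑ j ∈ Finset.range n, γ ^ (j + 1) * c (i + (j + 1)) * e (n + 1 - (j + 1))
        = γ * ∑ j ∈ Finset.range n, γ ^ j * c (i + 1 + j) * e (n - j) := by
      rw [Finset.mul_sum]
      refine Finset.sum_congr rfl fun j _ => ?_
      rw [show i + (j + 1) = i + 1 + j by omega, Nat.add_sub_add_right]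
      ring
    rw [hsum]
    simp only [pow_zero, one_mul, add_zero, Nat.sub_zero, pow_succ]
    linarith

theorem bOp_le_errOf_add {S A : Type*} [Fintype S] [Fintype A] [DecidableEq S] [Nonempty A]
    (P : S → A → S → ℝ) (γ : ℝ) (r v : S → ℝ) (π π' : S → A) (s : S) :
    bOp P γ r π' v s ≤ errOf P γ r v π s + bOp P γ r π v s := by
  have h := Finset.le_sup' (fun π' : S → A => bOp P γ r π' v s) (Finset.mem_univ π')
  simp only [errOf]
  linarith

theorem errOf_nonneg {S A : Type*} [Fintype S] [Fintype A] [DecidableEq S] [Nonempty A]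
    (P : S → A → S → ℝ) (γ : ℝ) (r v : S → ℝ) (π : S → A) (s : S) :
    0 ≤ errOf P γ r v π s := by
  linarith [bOp_le_errOf_add P γ r v π π s]

/-- A fixed point of a Bellman operator is at most `R / (1 - γ)` when the reward is at most `R`. -/
theorem le_div_of_bOp_eq {S A : Type*} [Fintype S] [Nonempty S] {P : S → A → S → ℝ}
    (hP0 : ∀ s a s', 0 ≤ P s a s') (hP1 : ∀ s a, ∑ s' : S, P s a s' = 1)
    {γ : ℝ} (hγ0 : 0 ≤ γ) (hγ1 : γ < 1) {R : ℝ} {r : S → ℝ} (hr : ∀ s, r s ≤ R)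
    {π : S → A} {v : S → ℝ} (hfix : bOp P γ r π v = v) (s : S) : v s ≤ R / (1 - γ) := by
  obtain ⟨m, hm⟩ := Finite.exists_max v
  refine (hm s).trans ?_
  rw [le_div_iff₀ (by linarith)]
  have havg : ∑ s', P m (π m) s' * v s' ≤ v m := by
    calc ∑ s', P m (π m) s' * v s' ≤ ∑ s', P m (π m) s' * v m :=
          Finset.sum_le_sum fun s' _ => mul_le_mul_of_nonneg_left (hm s') (hP0 _ _ _)
      _ = v m := by rw [← Finset.sum_mul, hP1, one_mul]
  have hval : r m + γ * ∑ s', P m (π m) s' * v s' = v m := congrFun hfix m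
  nlinarith [mul_le_mul_of_nonneg_left havg hγ0, hr m]

theorem vecMul_polMat_pow_nonneg {S A : Type*} [Fintype S] [DecidableEq S] {P : S → A → S → ℝ}
    (hP0 : ∀ s a s', 0 ≤ P s a s') (π : S → A) {μ : S → ℝ} (hμ : ∀ s, 0 ≤ μ s) (i : ℕ) :
    ∀ s, 0 ≤ Matrix.vecMul μ (polMat P π ^ i) s := by
  induction i with
  | zero => simpa using hμ
  | succ i ih =>
    intro s
    rw [pow_succ, ← Matrix.vecMul_vecMul]
    exact Finset.sum_nonneg fun s' _ => mul_nonneg (ih s') (hP0 _ _ _)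

theorem vecMul_polMat_pow_succ_sum {S A : Type*} [Fintype S] [DecidableEq S] (P : S → A → S → ℝ)
    (π : S → A) (μ w : S → ℝ) (i : ℕ) :
    ∑ s, Matrix.vecMul μ (polMat P π ^ (i + 1)) s * w s
      = ∑ s, Matrix.vecMul μ (polMat P π ^ i) s * ∑ s', P s (π s) s' * w s' := by
  rw [pow_succ, ← Matrix.vecMul_vecMul]
  exact (Matrix.dotProduct_mulVec _ (polMat P π) w).symm

theorem sum_vecMul_polMat_pow {S A : Type*} [Fintype S] [DecidableEq S] {P : S → A → S → ℝ}
    (hP1 : ∀ s a, ∑ s' : S, P s a s' = 1) (π : S → A) (μ : S → ℝ) (i : ℕ) :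
    ∑ s, Matrix.vecMul μ (polMat P π ^ i) s = ∑ s, μ s := by
  induction i with
  | zero => simp
  | succ i ih =>
    have h := vecMul_polMat_pow_succ_sum P π μ (fun _ => 1) i
    simp only [mul_one, hP1] at h
    rw [h, ih]

/-- if `ν e_j ≤ ε_j ≤ ε` for `1 ≤ j ≤ k` then
`μ(v_{π*} − v_{σ_k}) ≤ Σ_{i=0}^{k−1} γ^i c_{π*}(i) ε_{k−i} + γ^k Vmax`, and in particular
`μ(v_{π*} − v_{σ_k}) ≤ (Σ_{i=0}^{k−1} γ^i c_{π*}(i)) ε + γ^k Vmax`. -/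
theorem stmt2
    {S A : Type*} [Fintype S] [Fintype A] [DecidableEq S] [Nonempty S] [Nonempty A]
    (P : S → A → S → ℝ) (hP0 : ∀ s a s', 0 ≤ P s a s')
    (hP1 : ∀ s a, ∑ s' : S, P s a s' = 1)
    (γ : ℝ) (hγ0 : 0 < γ) (hγ1 : γ < 1)
    (Rmax Vmax : ℝ) (r : S → ℝ) (hr : ∀ s, |r s| ≤ Rmax)
    (hVmax : Vmax = Rmax / (1 - γ))
    (πstar : S → A) (vstar : S → ℝ)
    (hfix : bOp P γ r πstar vstar = vstar)
    (hopt : ∀ (π : S → A) (v : S → ℝ), bOp P γ r π v = v → ∀ s, v s ≤ vstar s)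
    (μ ν : S → ℝ) (hμ0 : ∀ s, 0 ≤ μ s) (hμ1 : ∑ s : S, μ s = 1)
    (hν0 : ∀ s, 0 ≤ ν s) (hν1 : ∑ s : S, ν s = 1)
    (cπ : ℕ → ℝ) (hcπ0 : ∀ i, 0 ≤ cπ i)
    (hcπ : ∀ (i : ℕ) (s : S), Matrix.vecMul μ ((polMat P πstar) ^ i) s ≤ cπ i * ν s)
    (πseq : ℕ → S → A) (k : ℕ) (hk : 1 ≤ k)
    (ε : ℝ) (hε : 0 ≤ ε) (εf : ℕ → ℝ) (hεf0 : ∀ j, 0 ≤ εf j)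
    (herr : ∀ j, 1 ≤ j → j ≤ k →
      (∑ s : S, ν s * errOf P γ r (vSig P γ r πseq (j - 1)) (πseq j) s) ≤ εf j ∧ εf j ≤ ε) :
    (∑ s : S, μ s * (vstar s - vSig P γ r πseq k s)) ≤
        (∑ i ∈ Finset.range k, γ ^ i * cπ i * εf (k - i)) + γ ^ k * Vmax
    ∧ (∑ s : S, μ s * (vstar s - vSig P γ r πseq k s)) ≤
        (∑ i ∈ Finset.range k, γ ^ i * cπ i) * ε + γ ^ k * Vmax := by
  have hm0 := vecMul_polMat_pow_nonneg hP0 πstar hμ0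
  have hm1 : ∀ i, ∑ s, Matrix.vecMul μ (polMat P πstar ^ i) s = 1 := fun i =>
    (sum_vecMul_polMat_pow hP1 πstar μ i).trans hμ1
  have hstar : ∀ s, r s + γ * ∑ s', P s (πstar s) s' * vstar s' = vstar s := fun s =>
    congrFun hfix s
  have hvV : ∀ s, vstar s ≤ Vmax := fun s => hVmax ▸
    le_div_of_bOp_eq hP0 hP1 hγ0.le hγ1 (fun s => (le_abs_self _).trans (hr s)) hfix s
  have hV0 : 0 ≤ Vmax := by
    obtain ⟨s⟩ := ‹Nonempty S›
    rw [hVmax]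
    exact div_nonneg ((abs_nonneg _).trans (hr s)) (by linarith)
  have hgap : ∀ s, vstar s - r s ≤ Vmax := by
    intro s
    have havg : ∑ s', P s (πstar s) s' * vstar s' ≤ Vmax := by
      calc ∑ s', P s (πstar s) s' * vstar s' ≤ ∑ s', P s (πstar s) s' * Vmax :=
            Finset.sum_le_sum fun s' _ => mul_le_mul_of_nonneg_left (hvV s') (hP0 _ _ _)
        _ = Vmax := by rw [← Finset.sum_mul, hP1, one_mul]
    nlinarith [mul_le_mul_of_nonneg_left havg hγ0.le, hstar s]
  have hmain := le_sum_of_step_le hγ0.le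
    (fun i n => ∑ s, Matrix.vecMul μ (polMat P πstar ^ i) s * (vstar s - vSig P γ r πseq n s))
    cπ εf k (V := Vmax)
    (by
      intro i
      calc ∑ s, Matrix.vecMul μ (polMat P πstar ^ i) s * (vstar s - r s)
          ≤ ∑ s, Matrix.vecMul μ (polMat P πstar ^ i) s * Vmax :=
            Finset.sum_le_sum fun s _ => mul_le_mul_of_nonneg_left (hgap s) (hm0 i s)
        _ = Vmax := by rw [← Finset.sum_mul, hm1, one_mul])
    (by
      intro i n hn
      set e := errOf P γ r (vSig P γ r πseq n) (πseq (n + 1)) with he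
      have hpt : ∀ s, vstar s - vSig P γ r πseq (n + 1) s ≤
          e s + γ * ∑ s', P s (πstar s) s' * (vstar s' - vSig P γ r πseq n s') := by
        intro s
        have h : r s + γ * ∑ s', P s (πstar s) s' * vSig P γ r πseq n s'
            ≤ e s + vSig P γ r πseq (n + 1) s :=
          bOp_le_errOf_add P γ r (vSig P γ r πseq n) (πseq (n + 1)) πstar s
        simp only [mul_sub, Finset.sum_sub_distrib]
        linarith [hstar s]
      have herrn : ∑ s, Matrix.vecMul μ (polMat P πstar ^ i) s * e s ≤ cπ i * εf (n + 1) := by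
        calc ∑ s, Matrix.vecMul μ (polMat P πstar ^ i) s * e s
            ≤ ∑ s, cπ i * ν s * e s := Finset.sum_le_sum fun s _ =>
              mul_le_mul_of_nonneg_right (hcπ i s) (errOf_nonneg _ _ _ _ _ s)
          _ = cπ i * ∑ s, ν s * e s := by simp only [mul_assoc, Finset.mul_sum]
          _ ≤ cπ i * εf (n + 1) :=
              mul_le_mul_of_nonneg_left (herr (n + 1) (by omega) hn).1 (hcπ0 i)
      calc ∑ s, Matrix.vecMul μ (polMat P πstar ^ i) s * (vstar s - vSig P γ r πseq (n + 1) s)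
          ≤ ∑ s, Matrix.vecMul μ (polMat P πstar ^ i) s *
              (e s + γ * ∑ s', P s (πstar s) s' * (vstar s' - vSig P γ r πseq n s')) :=
            Finset.sum_le_sum fun s _ => mul_le_mul_of_nonneg_left (hpt s) (hm0 i s)
        _ = ∑ s, Matrix.vecMul μ (polMat P πstar ^ i) s * e s + γ * ∑ s,
              Matrix.vecMul μ (polMat P πstar ^ (i + 1)) s *
                (vstar s - vSig P γ r πseq n s) := by
            rw [vecMul_polMat_pow_succ_sum, Finset.mul_sum, ← Finset.sum_add_distrib]
            exact Finset.sum_congr rfl fun s _ => by ring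
        _ ≤ _ := by gcongr)
    k le_rfl 0
  simp only [pow_zero, Matrix.vecMul_one, zero_add] at hmain
  refine ⟨hmain, hmain.trans ?_⟩
  rw [Finset.sum_mul]
  gcongr with i hi
  · exact mul_nonneg (pow_nonneg hγ0.le i) (hcπ0 i)
  · have := Finset.mem_range.mp hi
    exact (herr (k - i) (by omega) (by omega)).2
end
end

section
/- For every integer k ≥ 1, the componentwise inequality v_{π*} − v_{k,m} ≤ Σ_{i=0}^{k−1} (γP_{π*})^i (I − Γ_{k−i,m})^{−1} e_{k−i} + 2 γ^k Vmax 𝟙 holds (each matrix I − Γ_{j,m} is invertible with nonnegative inverse since the entries of Γ_{j,m} are nonnegative with row sums γ^m < 1). -/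
open Finset Matrix

noncomputable section

/-- The composed NSPI operator
`nsRun P γ r πseq j m v = T_{π_j} T_{π_{j−1}} ⋯ T_{π_{j−m+1}} v` (identity for `m = 0`). -/
def nsRun {S A : Type*} [Fintype S] (P : S → A → S → ℝ) (γ : ℝ) (r : S → ℝ)
    (πseq : ℤ → S → A) : ℤ → ℕ → (S → ℝ) → (S → ℝ)
  | _, 0, v => v
  | j, m+1, v => bOp P γ r (πseq j) (nsRun P γ r πseq (j-1) m v)

/-- `gamMat P γ πseq j m = Γ_{j,m} = (γP_{π_j})(γP_{π_{j−1}})⋯(γP_{π_{j−m+1}})`. -/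
def gamMat {S A : Type*} [Fintype S] [DecidableEq S]
    (P : S → A → S → ℝ) (γ : ℝ) (πseq : ℤ → S → A) (j : ℤ) (m : ℕ) : Matrix S S ℝ :=
  ((List.range m).map fun i => γ • polMat P (πseq (j - (i : ℤ)))).prod

theorem bOp_sub_eq_mulVec {S A : Type*} [Fintype S] (P : S → A → S → ℝ) (γ : ℝ) (r : S → ℝ)
    (π : S → A) (v w : S → ℝ) :
    bOp P γ r π v - bOp P γ r π w = (γ • polMat P π) *ᵥ (v - w) := by
  funext s
  rw [Matrix.smul_mulVec]
  simp only [bOp, polMat, Pi.sub_apply, Pi.smul_apply, smul_eq_mul,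
    Matrix.mulVec, dotProduct, Matrix.of_apply, mul_sub, Finset.sum_sub_distrib]
  ring

theorem gamMat_eq_prod_map {S A : Type*} [Fintype S] [DecidableEq S] (P : S → A → S → ℝ) (γ : ℝ)
    (πseq : ℤ → S → A) (j : ℤ) (m : ℕ) :
    gamMat P γ πseq j m
      = ((List.range m).map fun i : ℕ => γ • polMat P (πseq (j - (i : ℤ)))).prod := by
  simp only [gamMat, bind_pure_comp, List.map_eq_map, List.map_map, Function.comp_def]

@[simp]
theorem gamMat_zero {S A : Type*} [Fintype S] [DecidableEq S] (P : S → A → S → ℝ) (γ : ℝ)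
    (πseq : ℤ → S → A) (j : ℤ) : gamMat P γ πseq j 0 = 1 := by
  simp [gamMat_eq_prod_map]

theorem gamMat_succ {S A : Type*} [Fintype S] [DecidableEq S] (P : S → A → S → ℝ) (γ : ℝ)
    (πseq : ℤ → S → A) (j : ℤ) (m : ℕ) :
    gamMat P γ πseq j (m + 1) = (γ • polMat P (πseq j)) * gamMat P γ πseq (j - 1) m := by
  simp only [gamMat_eq_prod_map, List.range_succ_eq_map, List.map_cons, List.map_map,
    List.prod_cons]
  congr 2
  · simp
  · refine List.map_congr_left fun i _ => ?_
    simp only [Function.comp_apply]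
    congr 3
    push_cast
    ring

theorem nsRun_sub_eq_mulVec {S A : Type*} [Fintype S] [DecidableEq S] (P : S → A → S → ℝ) (γ : ℝ)
    (r : S → ℝ) (πseq : ℤ → S → A) (m : ℕ) (j : ℤ) (v w : S → ℝ) :
    nsRun P γ r πseq j m v - nsRun P γ r πseq j m w = gamMat P γ πseq j m *ᵥ (v - w) := by
  induction m generalizing j with
  | zero => simp [nsRun]
  | succ m ih => rw [nsRun, nsRun, bOp_sub_eq_mulVec, ih, gamMat_succ, Matrix.mulVec_mulVec]

theorem nsRun_succ_right {S A : Type*} [Fintype S] (P : S → A → S → ℝ) (γ : ℝ)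
    (r : S → ℝ) (πseq : ℤ → S → A) (m : ℕ) (j : ℤ) (v : S → ℝ) :
    nsRun P γ r πseq j (m + 1) v = nsRun P γ r πseq j m (bOp P γ r (πseq (j - m)) v) := by
  induction m generalizing j with
  | zero => simp [nsRun]
  | succ m ih =>
    rw [nsRun, ih, nsRun]
    congr 4
    push_cast
    ring

theorem smul_polMat_nonneg {S A : Type*} {P : S → A → S → ℝ} (hP0 : ∀ s a s', 0 ≤ P s a s')
    {γ : ℝ} (hγ0 : 0 ≤ γ) (π : S → A) (s s' : S) : 0 ≤ (γ • polMat P π) s s' :=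
  mul_nonneg hγ0 (hP0 s (π s) s')

theorem smul_polMat_mulVec_one {S A : Type*} [Fintype S] {P : S → A → S → ℝ}
    (hP1 : ∀ s a, ∑ s' : S, P s a s' = 1) (γ : ℝ) (π : S → A) :
    (γ • polMat P π) *ᵥ 1 = γ • (1 : S → ℝ) := by
  funext s
  rw [Matrix.smul_mulVec]
  simp [Matrix.mulVec, dotProduct, polMat, hP1]

theorem gamMat_nonneg {S A : Type*} [Fintype S] [DecidableEq S] {P : S → A → S → ℝ}
    (hP0 : ∀ s a s', 0 ≤ P s a s') {γ : ℝ} (hγ0 : 0 ≤ γ) (πseq : ℤ → S → A) (m : ℕ) (j : ℤ)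
    (s s' : S) : 0 ≤ gamMat P γ πseq j m s s' := by
  induction m generalizing j s with
  | zero =>
    simp only [gamMat_zero, Matrix.one_apply]
    split_ifs <;> norm_num
  | succ m ih =>
    rw [gamMat_succ, Matrix.mul_apply]
    exact Finset.sum_nonneg fun t _ => mul_nonneg (smul_polMat_nonneg hP0 hγ0 _ _ _) (ih _ _)

theorem gamMat_mulVec_one {S A : Type*} [Fintype S] [DecidableEq S] {P : S → A → S → ℝ}
    (hP1 : ∀ s a, ∑ s' : S, P s a s' = 1) (γ : ℝ) (πseq : ℤ → S → A) (m : ℕ) (j : ℤ) :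
    gamMat P γ πseq j m *ᵥ 1 = γ ^ m • (1 : S → ℝ) := by
  induction m generalizing j with
  | zero => simp
  | succ m ih =>
    rw [gamMat_succ, ← Matrix.mulVec_mulVec, ih, Matrix.mulVec_smul, smul_polMat_mulVec_one hP1,
      smul_smul, pow_succ]

theorem mulVec_mono_of_nonneg {S : Type*} [Fintype S] {M : Matrix S S ℝ}
    (hM : ∀ s s', 0 ≤ M s s') {u w : S → ℝ} (h : u ≤ w) : M *ᵥ u ≤ M *ᵥ w :=
  fun s => Finset.sum_le_sum fun t _ => mul_le_mul_of_nonneg_left (h t) (hM s t)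

/-- A subsolution of `u ≤ M u` is nonpositive when `M` is nonnegative with row sums `c < 1`. -/
theorem nonpos_of_le_mulVec {S : Type*} [Fintype S] {M : Matrix S S ℝ}
    (hM : ∀ s s', 0 ≤ M s s') {c : ℝ} (hc : c < 1) (hrow : M *ᵥ 1 = c • (1 : S → ℝ))
    {u : S → ℝ} (hu : u ≤ M *ᵥ u) : u ≤ 0 := by
  intro s
  have : Nonempty S := ⟨s⟩
  obtain ⟨t, ht⟩ := Finite.exists_max u
  have hle : u ≤ u t • (1 : S → ℝ) := fun i => by simpa using ht i
  have h := (hu t).trans (mulVec_mono_of_nonneg hM hle t)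
  rw [Matrix.mulVec_smul, hrow] at h
  simp only [Pi.smul_apply, Pi.one_apply, smul_eq_mul, mul_one] at h
  have : u t ≤ 0 := by nlinarith
  exact (ht s).trans this

theorem isUnit_one_sub_of_row_sum_lt_one {S : Type*} [Fintype S] [DecidableEq S]
    {M : Matrix S S ℝ} (hM : ∀ s s', 0 ≤ M s s') {c : ℝ} (hc : c < 1)
    (hrow : M *ᵥ 1 = c • (1 : S → ℝ)) : IsUnit (1 - M) := by
  rw [← Matrix.mulVec_injective_iff_isUnit]
  intro x y hxy
  simp only [Matrix.sub_mulVec, Matrix.one_mulVec] at hxy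
  have h : x - y = M *ᵥ (x - y) := by
    rw [Matrix.mulVec_sub]
    linear_combination hxy
  have h' : y - x = M *ᵥ (y - x) := by
    rw [Matrix.mulVec_sub]
    linear_combination -hxy
  exact le_antisymm (sub_nonpos.mp (nonpos_of_le_mulVec hM hc hrow h.le))
    (sub_nonpos.mp (nonpos_of_le_mulVec hM hc hrow h'.le))

/-- Comparison principle for `I - M`, with `M` nonnegative with row sums `c < 1`. -/
theorem le_inv_one_sub_mulVec {S : Type*} [Fintype S] [DecidableEq S]
    {M : Matrix S S ℝ} (hM : ∀ s s', 0 ≤ M s s') {c : ℝ} (hc : c < 1)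
    (hrow : M *ᵥ 1 = c • (1 : S → ℝ)) {y e : S → ℝ} (h : y ≤ M *ᵥ y + e) :
    y ≤ (1 - M)⁻¹ *ᵥ e := by
  have hdet := (Matrix.isUnit_iff_isUnit_det _).mp (isUnit_one_sub_of_row_sum_lt_one hM hc hrow)
  have hz : (1 - M) *ᵥ ((1 - M)⁻¹ *ᵥ e) = e := by
    rw [Matrix.mulVec_mulVec, Matrix.mul_nonsing_inv _ hdet, Matrix.one_mulVec]
  rw [Matrix.sub_mulVec, Matrix.one_mulVec] at hz
  refine sub_nonpos.mp (nonpos_of_le_mulVec hM hc hrow ?_)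
  rw [Matrix.mulVec_sub]
  intro s
  have h1 := h s
  have h2 := congrFun hz s
  simp only [Pi.sub_apply, Pi.add_apply] at *
  linarith

theorem abs_nsRun_le {S A : Type*} [Fintype S] {P : S → A → S → ℝ}
    (hP0 : ∀ s a s', 0 ≤ P s a s') (hP1 : ∀ s a, ∑ s' : S, P s a s' = 1)
    {γ : ℝ} (hγ0 : 0 ≤ γ) {Vmax : ℝ} {r : S → ℝ} (hr : ∀ s, |r s| ≤ (1 - γ) * Vmax)
    (πseq : ℤ → S → A) {v : S → ℝ} {d : ℝ} (hv : ∀ s, |v s| ≤ Vmax + d) (m : ℕ) (j : ℤ) (s : S) :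
    |nsRun P γ r πseq j m v s| ≤ Vmax + γ ^ m * d := by
  induction m generalizing j s with
  | zero => simpa [nsRun] using hv s
  | succ m ih =>
    set w := nsRun P γ r πseq (j - 1) m v with hw
    have hsum : |∑ s', P s (πseq j s) s' * w s'| ≤ Vmax + γ ^ m * d :=
      calc |∑ s', P s (πseq j s) s' * w s'| ≤ ∑ s', |P s (πseq j s) s' * w s'| :=
            Finset.abs_sum_le_sum_abs _ _
        _ ≤ ∑ s', P s (πseq j s) s' * (Vmax + γ ^ m * d) := by
            refine Finset.sum_le_sum fun t _ => ?_
            rw [abs_mul, abs_of_nonneg (hP0 _ _ _)]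
            exact mul_le_mul_of_nonneg_left (ih _ _) (hP0 _ _ _)
        _ = Vmax + γ ^ m * d := by rw [← Finset.sum_mul, hP1, one_mul]
    calc |nsRun P γ r πseq j (m + 1) v s|
        ≤ |r s| + |γ * ∑ s', P s (πseq j s) s' * w s'| := abs_add_le _ _
      _ ≤ (1 - γ) * Vmax + γ * (Vmax + γ ^ m * d) := by
          rw [abs_mul, abs_of_nonneg hγ0]
          exact add_le_add (hr s) (mul_le_mul_of_nonneg_left hsum hγ0)
      _ = Vmax + γ ^ (m + 1) * d := by ring

theorem abs_le_of_nsRun_eq_self {S A : Type*} [Fintype S] {P : S → A → S → ℝ}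
    (hP0 : ∀ s a s', 0 ≤ P s a s') (hP1 : ∀ s a, ∑ s' : S, P s a s' = 1)
    {γ : ℝ} (hγ0 : 0 ≤ γ) (hγ1 : γ < 1) {Vmax : ℝ} {r : S → ℝ}
    (hr : ∀ s, |r s| ≤ (1 - γ) * Vmax) (πseq : ℤ → S → A) {v : S → ℝ} {m : ℕ} (hm : m ≠ 0)
    {j : ℤ} (h : nsRun P γ r πseq j m v = v) (s : S) : |v s| ≤ Vmax := by
  have : Nonempty S := ⟨s⟩
  obtain ⟨t, ht⟩ := Finite.exists_max fun s => |v s|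
  have hbound := abs_nsRun_le hP0 hP1 hγ0 hr πseq (v := v) (d := |v t| - Vmax)
    (fun i => by linarith [ht i]) m j t
  rw [h] at hbound
  have hpow := pow_lt_one₀ hγ0 hγ1 hm
  have : |v t| ≤ Vmax := by nlinarith
  exact (ht s).trans this

theorem bOp_le_add_errOf {S A : Type*} [Fintype S] [Fintype A] [DecidableEq S] [Nonempty A]
    (P : S → A → S → ℝ) (γ : ℝ) (r v : S → ℝ) (π π' : S → A) :
    bOp P γ r π' v ≤ bOp P γ r π v + errOf P γ r v π := by
  intro s
  have := Finset.le_sup' (fun π' : S → A => bOp P γ r π' v s) (Finset.mem_univ π')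
  simp only [Pi.add_apply, errOf]
  linarith

/-- One step of NSPI: the loss of the next policy in terms of the loss of the current one. -/
theorem sub_le_mulVec_add_of_nsRun_eq_self {S A : Type*} [Fintype S] [Fintype A] [DecidableEq S]
    [Nonempty A] {P : S → A → S → ℝ} (hP0 : ∀ s a s', 0 ≤ P s a s')
    (hP1 : ∀ s a, ∑ s' : S, P s a s' = 1) {γ : ℝ} (hγ0 : 0 ≤ γ) (hγ1 : γ < 1) {r : S → ℝ}
    {πstar : S → A} {vstar : S → ℝ} (hfix : bOp P γ r πstar vstar = vstar) {m : ℕ} (hm : m ≠ 0)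
    (πseq : ℤ → S → A) (j : ℤ) {v w : S → ℝ} (hv : nsRun P γ r πseq j m v = v)
    (hw : nsRun P γ r πseq (j + 1) m w = w) :
    vstar - w ≤ (γ • polMat P πstar) *ᵥ (vstar - v)
      + (1 - gamMat P γ πseq (j + 1) m)⁻¹ *ᵥ errOf P γ r v (πseq (j + 1)) := by
  set e := errOf P γ r v (πseq (j + 1)) with he
  set Γ := gamMat P γ πseq (j + 1) m with hΓ
  set x := bOp P γ r (πseq (j + 1)) v - w with hx
  have hΓ0 : ∀ s s', 0 ≤ Γ s s' := gamMat_nonneg hP0 hγ0 πseq m (j + 1)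
  have hrun : bOp P γ r (πseq (j + 1)) v
      = nsRun P γ r πseq (j + 1) m (bOp P γ r (πseq (j + 1 - m)) v) := by
    rw [← nsRun_succ_right, nsRun, add_sub_cancel_right, hv]
  have hxΓ : x = Γ *ᵥ (bOp P γ r (πseq (j + 1 - m)) v - w) := by
    rw [← nsRun_sub_eq_mulVec (r := r), ← hrun, hw]
  have hxe : x ≤ Γ *ᵥ (x + e) := by
    refine hxΓ.le.trans (mulVec_mono_of_nonneg hΓ0 fun s => ?_)
    have := bOp_le_add_errOf P γ r v (πseq (j + 1)) (πseq (j + 1 - m)) s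
    simp only [hx, he, Pi.sub_apply, Pi.add_apply] at *
    linarith
  have hinv : x + e ≤ (1 - Γ)⁻¹ *ᵥ e :=
    le_inv_one_sub_mulVec hΓ0 (pow_lt_one₀ hγ0 hγ1 hm) (gamMat_mulVec_one hP1 γ πseq m (j + 1))
      (add_le_add_left hxe e)
  intro s
  have h1 := hinv s
  have h2 := bOp_le_add_errOf P γ r v (πseq (j + 1)) πstar s
  have h3 := congrFun (bOp_sub_eq_mulVec P γ r πstar vstar v) s
  rw [hfix] at h3
  simp only [hx, Pi.sub_apply, Pi.add_apply] at *
  linarith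

/-- for NSPI(m), for every `k ≥ 1`, componentwise,
`v_{π*} − v_{k,m} ≤ Σ_{i=0}^{k−1} (γP_{π*})^i (I − Γ_{k−i,m})^{−1} e_{k−i} + 2 γ^k Vmax 𝟙`,
where `v_{j,m}` is the fixed point of `v ↦ T_{π_j}⋯T_{π_{j−m+1}} v` and
`e_{j} = max_{π'} T_{π'} v_{j−1,m} − T_{π_j} v_{j−1,m}`. -/
theorem stmt5
    {S A : Type*} [Fintype S] [Fintype A] [DecidableEq S] [Nonempty S] [Nonempty A]
    (P : S → A → S → ℝ) (hP0 : ∀ s a s', 0 ≤ P s a s')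
    (hP1 : ∀ s a, ∑ s' : S, P s a s' = 1)
    (γ : ℝ) (hγ0 : 0 < γ) (hγ1 : γ < 1)
    (Rmax Vmax : ℝ) (r : S → ℝ) (hr : ∀ s, |r s| ≤ Rmax)
    (hVmax : Vmax = Rmax / (1 - γ))
    (πstar : S → A) (vstar : S → ℝ)
    (hfix : bOp P γ r πstar vstar = vstar)
    (hopt : ∀ (π : S → A) (v : S → ℝ), bOp P γ r π v = v → ∀ s, v s ≤ vstar s)
    (m : ℕ) (hm : 1 ≤ m) (πseq : ℤ → S → A)
    (vN : ℕ → S → ℝ)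
    (hvN : ∀ j : ℕ, nsRun P γ r πseq (j : ℤ) m (vN j) = vN j)
    (k : ℕ) (hk : 1 ≤ k) :
    ∀ s, vstar s - vN k s ≤
      (∑ i ∈ Finset.range k,
        (((γ • polMat P πstar) ^ i)
            * (1 - gamMat P γ πseq ((k - i : ℕ) : ℤ) m)⁻¹).mulVec
          (errOf P γ r (vN (k - i - 1)) (πseq ((k - i : ℕ) : ℤ))) s)
        + 2 * γ ^ k * Vmax := by
  have hγ0' := hγ0.le
  have hm' : m ≠ 0 := by omega
  have hr' : ∀ s, |r s| ≤ (1 - γ) * Vmax := fun s => by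
    rw [hVmax, mul_div_cancel₀ _ (by linarith)]
    exact hr s
  clear hk
  induction k with
  | zero =>
    intro s
    have h1 := abs_le.mp (abs_le_of_nsRun_eq_self hP0 hP1 hγ0' hγ1 hr' πseq hm' (hvN 0) s)
    have h2 := abs_le.mp (abs_le_of_nsRun_eq_self hP0 hP1 hγ0' hγ1 hr' (fun _ => πstar)
      one_ne_zero (j := 0) hfix s)
    simp only [Finset.range_zero, Finset.sum_empty, pow_zero]
    linarith
  | succ k ih =>
    intro s
    set Q := γ • polMat P πstar with hQ
    set b : ℕ → S → ℝ := fun i => (Q ^ i * (1 - gamMat P γ πseq ((k - i : ℕ) : ℤ) m)⁻¹) *ᵥ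
      errOf P γ r (vN (k - i - 1)) (πseq ((k - i : ℕ) : ℤ)) with hb
    have hstep := sub_le_mulVec_add_of_nsRun_eq_self hP0 hP1 hγ0' hγ1 hfix hm' πseq k (hvN k)
      (by exact_mod_cast hvN (k + 1)) s
    have hle : vstar - vN k ≤ ∑ i ∈ Finset.range k, b i + (2 * γ ^ k * Vmax) • (1 : S → ℝ) :=
      fun t => by simpa [hb] using ih t
    have hmono := mulVec_mono_of_nonneg (smul_polMat_nonneg hP0 hγ0' πstar) hle s
    rw [Matrix.mulVec_add, Matrix.mulVec_smul, smul_polMat_mulVec_one hP1,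
      Matrix.mulVec_sum] at hmono
    rw [Finset.sum_range_succ']
    simp only [Pi.add_apply, Finset.sum_apply, Pi.smul_apply, Pi.one_apply, smul_eq_mul,
      mul_one, Pi.sub_apply, hb, Matrix.mulVec_mulVec, ← mul_assoc] at hstep hmono
    simp only [Nat.add_sub_add_right, pow_succ' Q, Nat.sub_zero, Nat.add_sub_cancel, pow_zero,
      one_mul, Nat.cast_add, Nat.cast_one]
    rw [pow_succ γ]
    linarith
end
end

section
/- For a single CPI-type step π_{k+1} = (1−α_{k+1})π_k + α_{k+1}π'_{k+1}, the componentwise inequality v_{π_k} − v_{π_{k+1}} ≤ α_{k+1} (I − γP_{π_{k+1}})^{−1} e_{k+1} holds. -/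
open Finset Matrix

noncomputable section

/-- Transition matrix of a stochastic stationary policy:
`P_π(s,s') = Σ_a π(a|s) P(s'|s,a)`. -/
def polMatS {S A : Type*} [Fintype A] (P : S → A → S → ℝ) (π : S → A → ℝ) :
    Matrix S S ℝ :=
  Matrix.of fun s s' => ∑ a : A, π s a * P s a s'

/-- Bellman operator of a stochastic stationary policy. -/
def bOpS {S A : Type*} [Fintype S] [Fintype A] (P : S → A → S → ℝ) (γ : ℝ) (r : S → ℝ)
    (π : S → A → ℝ) (v : S → ℝ) : S → ℝ :=
  fun s => r s + γ * ∑ s' : S, (∑ a : A, π s a * P s a s') * v s'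

/-- A deterministic policy viewed as a stochastic one. -/
def detPol {S A : Type*} [DecidableEq A] (π : S → A) : S → A → ℝ :=
  fun s a => if a = π s then 1 else 0

/-- Per-state mixture `(1−α)π + απ'` of two stochastic policies. -/
def mixPol {S A : Type*} (α : ℝ) (π π' : S → A → ℝ) : S → A → ℝ :=
  fun s a => (1 - α) * π s a + α * π' s a

/-- `π` is a stochastic stationary policy. -/
def isStoch {S A : Type*} [Fintype A] (π : S → A → ℝ) : Prop :=
  (∀ s a, 0 ≤ π s a) ∧ ∀ s, ∑ a : A, π s a = 1

/-- The CPI sequence `π_0`, `π_i = (1−α_i)π_{i−1} + α_i π'_i`. -/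
def cpiSeq {S A : Type*} [DecidableEq A] (π0 : S → A → ℝ) (αf : ℕ → ℝ)
    (π'f : ℕ → S → A) : ℕ → S → A → ℝ
  | 0 => π0
  | i+1 => mixPol (αf (i+1)) (cpiSeq π0 αf π'f i) (detPol (π'f (i+1)))

theorem isStoch_detPol {S A : Type*} [Fintype A] [DecidableEq A] (π : S → A) :
    isStoch (detPol π) :=
  ⟨fun s a => by unfold detPol; split_ifs <;> norm_num, fun s => by simp [detPol]⟩

theorem isStoch.mixPol {S A : Type*} [Fintype A] {π π' : S → A → ℝ} (hπ : isStoch π)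
    (hπ' : isStoch π') {α : ℝ} (hα0 : 0 ≤ α) (hα1 : α ≤ 1) : isStoch (mixPol α π π') := by
  refine ⟨fun s a => ?_, fun s => ?_⟩
  · exact add_nonneg (mul_nonneg (sub_nonneg.2 hα1) (hπ.1 s a)) (mul_nonneg hα0 (hπ'.1 s a))
  · simp [_root_.mixPol, Finset.sum_add_distrib, ← Finset.mul_sum, hπ.2, hπ'.2]

theorem polMatS_nonneg {S A : Type*} [Fintype A] {P : S → A → S → ℝ}
    (hP0 : ∀ s a s', 0 ≤ P s a s') {π : S → A → ℝ} (hπ : isStoch π) (s s' : S) :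
    0 ≤ polMatS P π s s' :=
  Finset.sum_nonneg fun a _ => mul_nonneg (hπ.1 s a) (hP0 s a s')

theorem sum_polMatS {S A : Type*} [Fintype S] [Fintype A] {P : S → A → S → ℝ}
    (hP1 : ∀ s a, ∑ s' : S, P s a s' = 1) {π : S → A → ℝ} (hπ : isStoch π) (s : S) :
    ∑ s', polMatS P π s s' = 1 := by
  simp only [polMatS, Matrix.of_apply]
  rw [Finset.sum_comm]
  simp [← Finset.mul_sum, hP1, hπ.2]

theorem bOpS_eq {S A : Type*} [Fintype S] [Fintype A] (P : S → A → S → ℝ) (γ : ℝ)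
    (r : S → ℝ) (π : S → A → ℝ) (v : S → ℝ) :
    bOpS P γ r π v = r + γ • polMatS P π *ᵥ v := by
  ext s
  simp [bOpS, polMatS, Matrix.mulVec, dotProduct]

theorem bOpS_apply_eq_sum {S A : Type*} [Fintype S] [Fintype A] (P : S → A → S → ℝ) (γ : ℝ)
    (r : S → ℝ) {π : S → A → ℝ} (hπ : isStoch π) (v : S → ℝ) (s : S) :
    bOpS P γ r π v s = ∑ a, π s a * bOp P γ r (fun _ => a) v s := by
  simp only [bOpS, bOp, mul_add, Finset.sum_add_distrib, ← Finset.sum_mul, hπ.2, one_mul,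
    mul_left_comm _ γ, ← Finset.mul_sum, add_right_inj]
  congr 1
  simp only [Finset.sum_mul, Finset.mul_sum, mul_assoc]
  exact Finset.sum_comm

theorem bOpS_detPol {S A : Type*} [Fintype S] [Fintype A] [DecidableEq A]
    (P : S → A → S → ℝ) (γ : ℝ) (r : S → ℝ) (π : S → A) (v : S → ℝ) :
    bOpS P γ r (detPol π) v = bOp P γ r π v := by
  ext s
  simp [bOpS, bOp, detPol]

theorem bOpS_mixPol {S A : Type*} [Fintype S] [Fintype A] (P : S → A → S → ℝ) (γ : ℝ)
    (r : S → ℝ) (α : ℝ) (π π' : S → A → ℝ) (v : S → ℝ) :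
    bOpS P γ r (mixPol α π π') v = (1 - α) • bOpS P γ r π v + α • bOpS P γ r π' v := by
  ext s
  simp only [bOpS, mixPol, add_mul, Finset.sum_add_distrib, mul_assoc, ← Finset.mul_sum,
    Pi.add_apply, Pi.smul_apply, smul_eq_mul]
  ring

theorem bOpS_le_sup' {S A : Type*} [Fintype S] [Fintype A] [DecidableEq S] [Nonempty A]
    (P : S → A → S → ℝ) (γ : ℝ) (r : S → ℝ) {π : S → A → ℝ} (hπ : isStoch π) (v : S → ℝ)
    (s : S) :
    bOpS P γ r π v s ≤
      Finset.univ.sup' Finset.univ_nonempty fun π' : S → A => bOp P γ r π' v s := by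
  rw [bOpS_apply_eq_sum P γ r hπ]
  set m := Finset.univ.sup' Finset.univ_nonempty fun π' : S → A => bOp P γ r π' v s
  have hm : ∀ a, bOp P γ r (fun _ => a) v s ≤ m := fun a =>
    Finset.le_sup' (fun π' : S → A => bOp P γ r π' v s) (Finset.mem_univ _)
  calc ∑ a, π s a * bOp P γ r (fun _ => a) v s
      ≤ ∑ a, π s a * m :=
        Finset.sum_le_sum fun a _ => mul_le_mul_of_nonneg_left (hm a) (hπ.1 s a)
    _ = m := by rw [← Finset.sum_mul, hπ.2, one_mul]

/-- Minimum principle for `1 - γ • M` with `M` row-stochastic. -/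
theorem nonneg_of_one_sub_smul_mulVec_nonneg {S : Type*} [Fintype S] [DecidableEq S]
    {M : Matrix S S ℝ} (hM0 : ∀ s s', 0 ≤ M s s') (hM1 : ∀ s, ∑ s', M s s' = 1)
    {γ : ℝ} (hγ0 : 0 ≤ γ) (hγ1 : γ < 1) {x : S → ℝ} (hx : 0 ≤ (1 - γ • M) *ᵥ x) : 0 ≤ x := by
  intro s₁
  have : Nonempty S := ⟨s₁⟩
  obtain ⟨s, hs⟩ := Finite.exists_min x
  have h := hx s
  have hle : x s ≤ (M *ᵥ x) s := by
    calc x s = ∑ s', M s s' * x s := by rw [← Finset.sum_mul, hM1, one_mul]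
      _ ≤ _ := Finset.sum_le_sum fun s' _ => mul_le_mul_of_nonneg_left (hs s') (hM0 s s')
  simp only [Matrix.sub_mulVec, Matrix.one_mulVec, Matrix.smul_mulVec, Pi.sub_apply,
    Pi.smul_apply, smul_eq_mul, Pi.zero_apply] at h
  have hxs : 0 ≤ x s := by nlinarith [mul_le_mul_of_nonneg_left hle hγ0]
  exact hxs.trans (hs s₁)

theorem isUnit_one_sub_smul {S : Type*} [Fintype S] [DecidableEq S]
    {M : Matrix S S ℝ} (hM0 : ∀ s s', 0 ≤ M s s') (hM1 : ∀ s, ∑ s', M s s' = 1)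
    {γ : ℝ} (hγ0 : 0 ≤ γ) (hγ1 : γ < 1) : IsUnit (1 - γ • M) := by
  rw [← Matrix.mulVec_injective_iff_isUnit]
  intro x y hxy
  have key : ∀ u v : S → ℝ, (1 - γ • M) *ᵥ u = (1 - γ • M) *ᵥ v → v ≤ u := fun u v h =>
    sub_nonneg.1 <| nonneg_of_one_sub_smul_mulVec_nonneg hM0 hM1 hγ0 hγ1 <| by
      rw [Matrix.mulVec_sub, h, sub_self]
  exact le_antisymm (key y x hxy.symm) (key x y hxy)

/-- for a single CPI-type step `π_{k+1} = (1−α_{k+1})π_k + α_{k+1}π'_{k+1}`,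
componentwise `v_{π_k} − v_{π_{k+1}} ≤ α_{k+1} (I − γP_{π_{k+1}})^{−1} e_{k+1}`, where
`e_{k+1} = max_{π'} T_{π'} v_{π_k} − T_{π'_{k+1}} v_{π_k}`. -/
theorem stmt10
    {S A : Type*} [Fintype S] [Fintype A] [DecidableEq S] [DecidableEq A]
    [Nonempty S] [Nonempty A]
    (P : S → A → S → ℝ) (hP0 : ∀ s a s', 0 ≤ P s a s')
    (hP1 : ∀ s a, ∑ s' : S, P s a s' = 1)
    (γ : ℝ) (hγ0 : 0 < γ) (hγ1 : γ < 1)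
    (Rmax Vmax : ℝ) (r : S → ℝ) (hr : ∀ s, |r s| ≤ Rmax)
    (hVmax : Vmax = Rmax / (1 - γ))
    (πk : S → A → ℝ) (hπk : isStoch πk)
    (π' : S → A) (α : ℝ) (hα0 : 0 ≤ α) (hα1 : α ≤ 1)
    (vk : S → ℝ) (hvk : bOpS P γ r πk vk = vk)
    (vk1 : S → ℝ) (hvk1 : bOpS P γ r (mixPol α πk (detPol π')) vk1 = vk1) :
    ∀ s, vk s - vk1 s ≤
      α * ((1 - γ • polMatS P (mixPol α πk (detPol π')))⁻¹).mulVec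
        (errOf P γ r vk π') s := by
  have hmix := hπk.mixPol (isStoch_detPol π') hα0 hα1
  have hM0 := polMatS_nonneg hP0 hmix
  have hM1 := sum_polMatS hP1 hmix
  have hstep : bOpS P γ r (mixPol α πk (detPol π')) vk = (1 - α) • vk + α • bOp P γ r π' vk := by
    rw [bOpS_mixPol, hvk, bOpS_detPol]
  rw [bOpS_eq] at hvk1 hstep
  set M := polMatS P (mixPol α πk (detPol π'))
  have hdet := (Matrix.isUnit_iff_isUnit_det _).1 (isUnit_one_sub_smul hM0 hM1 hγ0.le hγ1)
  have hnonneg : 0 ≤ α • (1 - γ • M)⁻¹ *ᵥ errOf P γ r vk π' - (vk - vk1) := by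
    refine nonneg_of_one_sub_smul_mulVec_nonneg hM0 hM1 hγ0.le hγ1 fun s => ?_
    rw [Matrix.mulVec_sub, Matrix.mulVec_smul, Matrix.mulVec_mulVec,
      Matrix.mul_nonsing_inv _ hdet, Matrix.one_mulVec]
    have h1 := congrFun hvk1 s
    have h2 := congrFun hstep s
    have h3 := bOpS_le_sup' P γ r hπk vk s
    rw [hvk] at h3
    simp only [Matrix.sub_mulVec, Matrix.mulVec_sub, Matrix.one_mulVec, Matrix.smul_mulVec,
      Pi.add_apply, Pi.sub_apply, Pi.smul_apply, Pi.zero_apply, smul_eq_mul, errOf] at h1 h2 ⊢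
    nlinarith [mul_le_mul_of_nonneg_left h3 hα0]
  exact fun s => sub_nonneg.1 (hnonneg s)
end
end
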